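/- Let L be a finite set of N ≥ 1 players, let f be a function from subsets of L to the reals, and define the multilinear extension h : ℝ^L → ℝ by h(x) = Σ_{R ⊆ L} (Π_{i ∈ R} x_i) · (Π_{i ∈ L \ R} (1 − x_i)) · f(R). Then for every player i ∈ L, the partial derivative of h with respect to x_i evaluated at the point (1/2, 1/2, …, 1/2) equals 2^{−(N−1)} · Σ_{R ⊆ L \ {i}} (f(R ∪ {i}) − f(R)). -/

import Mathlib

open Finset

/-- The multilinear extension of the cooperative game on player set `L` with
characteristic function `f`. -/
noncomputable def mle {ι : Type*} [DecidableEq ι] (L : Finset ι)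
    (f : Finset ι → ℝ) (x : ι → ℝ) : ℝ :=
  ∑ R ∈ L.powerset, (∏ i ∈ R, x i) * (∏ i ∈ L \ R, (1 - x i)) * f R

/-- Splitting off one player: the multilinear extension is affine in each coordinate. -/
theorem mle_insert {ι : Type*} [DecidableEq ι] {M : Finset ι} {i : ι} (hi : i ∉ M)
    (f : Finset ι → ℝ) (x : ι → ℝ) :
    mle (insert i M) f x
      = mle M f x + x i * mle M (fun R => f (insert i R) - f R) x := by
  unfold mle
  rw [sum_powerset_insert hi, mul_sum, ← sum_add_distrib, ← sum_add_distrib]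
  refine sum_congr rfl fun R hR => ?_
  have hiR : i ∉ R := fun h => hi (mem_powerset.1 hR h)
  rw [insert_sdiff_of_notMem M hiR, prod_insert (fun h => hi (mem_sdiff.1 h).1),
    prod_insert hiR, insert_sdiff_insert, sdiff_insert_of_notMem hi]
  ring

theorem mle_congr {ι : Type*} [DecidableEq ι] {L : Finset ι} (f : Finset ι → ℝ)
    {x y : ι → ℝ} (h : ∀ j ∈ L, x j = y j) : mle L f x = mle L f y := by
  refine sum_congr rfl fun R hR => ?_
  have hR' : ∏ j ∈ R, x j = ∏ j ∈ R, y j :=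
    prod_congr rfl fun j hj => h j (mem_powerset.1 hR hj)
  have hLR : ∏ j ∈ L \ R, (1 - x j) = ∏ j ∈ L \ R, (1 - y j) :=
    prod_congr rfl fun j hj => by rw [h j (mem_sdiff.1 hj).1]
  rw [hR', hLR]

theorem mle_const_half {ι : Type*} [DecidableEq ι] (L : Finset ι) (f : Finset ι → ℝ) :
    mle L f (Function.const ι (1 / 2 : ℝ)) = ((2 : ℝ) ^ L.card)⁻¹ * ∑ R ∈ L.powerset, f R := by
  rw [mle, mul_sum]
  refine sum_congr rfl fun R hR => ?_
  have hcard : R.card + (L \ R).card = L.card := by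
    rw [add_comm, card_sdiff_add_card_eq_card (mem_powerset.1 hR)]
  have hhalf : (1 - 1 / 2 : ℝ) = 1 / 2 := by norm_num
  simp only [Function.const_apply, hhalf, prod_const]
  rw [← pow_add, hcard, one_div, inv_pow]

/-- The Banzhaf–Coleman formula: the `i`-th partial derivative of the
multilinear extension at the point `(1/2, …, 1/2)` equals `2^{-(N-1)}` times
the swing sum of player `i`. -/
theorem banzhaf_eq_deriv_mle_half {ι : Type*} [DecidableEq ι] (L : Finset ι)
    (hN : 1 ≤ L.card) (f : Finset ι → ℝ) (i : ι) (hi : i ∈ L) :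
    deriv (fun s : ℝ => mle L f (Function.update (Function.const ι (1/2 : ℝ)) i s))
        (1/2 : ℝ)
      = ((2:ℝ) ^ (L.card - 1))⁻¹
          * ∑ R ∈ (L.erase i).powerset, (f (insert i R) - f R) := by
  have hupdate (g : Finset ι → ℝ) (s : ℝ) :
      mle (L.erase i) g (Function.update (Function.const ι (1 / 2 : ℝ)) i s)
        = mle (L.erase i) g (Function.const ι (1 / 2 : ℝ)) :=
    mle_congr g fun j hj => Function.update_of_ne (ne_of_mem_erase hj) _ _
  have haffine (s : ℝ) :
      mle L f (Function.update (Function.const ι (1 / 2 : ℝ)) i s)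
        = mle (L.erase i) f (Function.const ι (1 / 2 : ℝ))
          + s * mle (L.erase i) (fun R => f (insert i R) - f R)
            (Function.const ι (1 / 2 : ℝ)) := by
    conv_lhs => rw [← insert_erase hi]
    rw [mle_insert (notMem_erase i L), hupdate, hupdate, Function.update_self]
  rw [← card_erase_of_mem hi, ← mle_const_half, funext haffine]
  exact (((hasDerivAt_id _).mul_const _).const_add _).deriv.trans (one_mul _)
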